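/- For every integer b ≥ 2 and every integer n ≥ b² + b, the number of smooth arithmetical structures (d, r) on D_n with d_x = b is exactly b². -/

import Mathlib

/-- `IsArith n dx dy d rx ry r` says that `(d, r)` is an arithmetical structure on the
bident `D_n` (with `ℓ = n - 3`): `dx, dy, rx, ry` are the values at the prong vertices
`v_x, v_y`, and `d i, r i` (for `0 ≤ i ≤ n - 3`) are the values at the path vertices
`v_0, v_1, …, v_ℓ`. -/
def IsArith (n dx dy : ℕ) (d : ℕ → ℕ) (rx ry : ℕ) (r : ℕ → ℕ) : Prop :=
  3 ≤ n ∧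
  0 < dx ∧ 0 < dy ∧ (∀ i, i ≤ n - 3 → 0 < d i) ∧
  0 < rx ∧ 0 < ry ∧ (∀ i, i ≤ n - 3 → 0 < r i) ∧
  dx * rx = r 0 ∧ dy * ry = r 0 ∧
  (1 ≤ n - 3 → d 0 * r 0 = rx + ry + r 1) ∧
  (n - 3 = 0 → d 0 * r 0 = rx + ry) ∧
  (∀ i, 1 ≤ i → i + 1 ≤ n - 3 → d i * r i = r (i - 1) + r (i + 1)) ∧
  (1 ≤ n - 3 → d (n - 3) * r (n - 3) = r (n - 3 - 1)) ∧
  (∀ c : ℕ, c ∣ rx → c ∣ ry → (∀ i, i ≤ n - 3 → c ∣ r i) → c = 1)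

/-- An arithmetical structure on `D_n` is *smooth* if `d_x, d_y ≥ 2` and `d_i ≥ 2` for all
`1 ≤ i ≤ ℓ = n - 3`. -/
def IsSmooth (n dx dy : ℕ) (d : ℕ → ℕ) : Prop :=
  2 ≤ dx ∧ 2 ≤ dy ∧ ∀ i, 1 ≤ i → i ≤ n - 3 → 2 ≤ d i

/-- The type of arithmetical structures on the bident `D_n`, represented canonically:
the label functions `d, r` are required to vanish beyond index `n - 3`. -/
structure ArithOn (n : ℕ) where
  dx : ℕ
  dy : ℕ
  d : ℕ → ℕ
  rx : ℕ
  ry : ℕ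
  r : ℕ → ℕ
  arith : IsArith n dx dy d rx ry r
  d_pad : ∀ i, n - 3 < i → d i = 0
  r_pad : ∀ i, n - 3 < i → r i = 0

/-- The type of smooth arithmetical structures on the bident `D_n`, represented canonically. -/
structure SmoothArithOn (n : ℕ) where
  dx : ℕ
  dy : ℕ
  d : ℕ → ℕ
  rx : ℕ
  ry : ℕ
  r : ℕ → ℕ
  arith : IsArith n dx dy d rx ry r
  smooth : IsSmooth n dx dy d
  d_pad : ∀ i, n - 3 < i → d i = 0
  r_pad : ∀ i, n - 3 < i → r i = 0

/-- The least nonnegative residue of `-x` modulo `y`. -/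
def negMod (x y : ℕ) : ℕ := (y - x % y) % y

theorem negMod_lt {x y : ℕ} (hy : 0 < y) : negMod x y < y := Nat.mod_lt _ hy

theorem negMod_zero_right (x : ℕ) : negMod x 0 = 0 := by simp [negMod]

theorem exists_mul_eq_add_negMod {x y : ℕ} (hy : 0 < y) : ∃ d, d * y = x + negMod x y := by
  have hlt := Nat.mod_lt x hy
  have hx := Nat.div_add_mod x y
  unfold negMod
  rcases Nat.eq_zero_or_pos (x % y) with h | h
  · refine ⟨x / y, ?_⟩
    rw [h, Nat.sub_zero, Nat.mod_self]
    linarith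
  · refine ⟨x / y + 1, ?_⟩
    rw [Nat.mod_eq_of_lt (Nat.sub_lt hy h), add_mul, mul_comm]
    omega

theorem negMod_eq_of_mul_eq_add {d x y z : ℕ} (h : d * y = x + z) (hz : z < y) :
    negMod x y = z := by
  obtain ⟨e, he⟩ := exists_mul_eq_add_negMod (x := x) (Nat.zero_lt_of_lt hz)
  have hlt := negMod_lt (x := x) (Nat.zero_lt_of_lt hz)
  have hmod : x + negMod x y ≡ x + z [MOD y] := by
    rw [← h, ← he]
    simp [Nat.ModEq]
  exact (hmod.add_left_cancel' x).eq_of_lt_of_lt hlt hz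

/-- The length of the negative continued fraction expansion of `x / y`. -/
def negCFLength (x y : ℕ) : ℕ :=
  if h : 0 < y then negCFLength y (negMod x y) + 1 else 0
termination_by y
decreasing_by exact negMod_lt h

theorem negCFLength_zero_right (x : ℕ) : negCFLength x 0 = 0 := by
  rw [negCFLength]; simp

theorem negCFLength_of_pos {x y : ℕ} (hy : 0 < y) :
    negCFLength x y = negCFLength y (negMod x y) + 1 := by
  rw [negCFLength]; simp [hy]

theorem negCFLength_of_mul_eq_add {d x y z : ℕ} (h : d * y = x + z) (hz : z < y) :
    negCFLength x y = negCFLength y z + 1 := by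
  rw [negCFLength_of_pos (Nat.zero_lt_of_lt hz), negMod_eq_of_mul_eq_add h hz]

theorem negCFLength_le (x y : ℕ) : negCFLength x y ≤ y := by
  induction y using Nat.strong_induction_on generalizing x with
  | _ y ih =>
    rcases Nat.eq_zero_or_pos y with rfl | hy
    · rw [negCFLength_zero_right]
    · have hlt := negMod_lt (x := x) hy
      have := ih _ hlt y
      rw [negCFLength_of_pos hy]
      omega

theorem negCFLength_mul {k : ℕ} (hk : 0 < k) (x y : ℕ) :
    negCFLength (k * x) (k * y) = negCFLength x y := by
  induction y using Nat.strong_induction_on generalizing x with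
  | _ y ih =>
    rcases Nat.eq_zero_or_pos y with rfl | hy
    · simp [negCFLength_zero_right]
    · obtain ⟨d, hd⟩ := exists_mul_eq_add_negMod (x := x) hy
      have hlt := negMod_lt (x := x) hy
      rw [negCFLength_of_pos hy, ← ih _ hlt y]
      refine negCFLength_of_mul_eq_add (d := d) ?_ (Nat.mul_lt_mul_of_pos_left hlt hk)
      rw [mul_left_comm, hd, mul_add]

theorem negCFLength_add_self_left (x y : ℕ) : negCFLength (x + y) y = negCFLength x y := by
  rcases Nat.eq_zero_or_pos y with rfl | hy
  · simp
  · obtain ⟨d, hd⟩ := exists_mul_eq_add_negMod (x := x) hy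
    rw [negCFLength_of_pos (x := x) hy]
    refine negCFLength_of_mul_eq_add (d := d + 1) ?_ (negMod_lt hy)
    rw [add_mul, hd]
    ring

theorem negCFLength_add_self_right {x : ℕ} (hx : 0 < x) (y : ℕ) :
    negCFLength x (y + x) = negCFLength x y + 1 := by
  rw [negCFLength_of_mul_eq_add (d := 1) (z := y) (by ring) (by omega), add_comm y x,
    negCFLength_add_self_left]

theorem negCFLength_add_mul_self_right {x : ℕ} (hx : 0 < x) (y k : ℕ) :
    negCFLength x (y + k * x) = negCFLength x y + k := by
  induction k with
  | zero => simp
  | succ k ih => rw [add_mul, one_mul, ← add_assoc, negCFLength_add_self_right hx, ih, add_assoc]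

theorem negCFLength_add_mul {m : ℕ} (hm : 0 < m) (s q : ℕ) :
    negCFLength (s + q * m + m) (s + q * m) = negCFLength m s + q := by
  induction q with
  | zero =>
    rw [zero_mul, add_zero, add_zero, add_comm s m, negCFLength_add_self_left]
  | succ q ih =>
    rw [← add_assoc, ← ih, show s + (q + 1) * m = s + q * m + m by ring]
    refine negCFLength_of_mul_eq_add (d := 2) ?_ ?_
    · ring
    · omega

theorem ncard_negCFLength_eq {x t : ℕ} (hx : 0 < x) (ht : x - 1 ≤ t) :
    {y | negCFLength x y = t}.ncard = x := by
  have hle : ∀ j < x, negCFLength x j ≤ t := fun j hj => by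
    have := negCFLength_le x j
    omega
  have himage : {y | negCFLength x y = t} =
      (fun j => j + (t - negCFLength x j) * x) '' Set.Iio x := by
    ext y
    simp only [Set.mem_ofPred_eq, Set.mem_image, Set.mem_Iio]
    constructor
    · intro hy
      refine ⟨y % x, Nat.mod_lt _ hx, ?_⟩
      have hdiv := Nat.mod_add_div' y x
      have h := negCFLength_add_mul_self_right hx (y % x) (y / x)
      rw [hdiv, hy] at h
      rw [h, Nat.add_sub_cancel_left, hdiv]
    · rintro ⟨j, hj, rfl⟩
      rw [negCFLength_add_mul_self_right hx]
      have := hle j hj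
      omega
  rw [himage, Set.InjOn.ncard_image, Set.ncard_eq_toFinset_card', Set.toFinset_Iio,
    Nat.card_Iio]
  intro i hi j hj hij
  have h := congrArg (· % x) hij
  simpa [Nat.mod_eq_of_lt hi, Nat.mod_eq_of_lt hj] using h

theorem negCFLength_bident_large {b c : ℕ} (hb : 2 ≤ b) (hc : b ^ 2 < b + c) :
    negCFLength (b * c) (b * c - b - c) = negCFLength (b ^ 2) (b + c - b ^ 2) + (b - 2) := by
  obtain ⟨a, rfl⟩ := Nat.exists_eq_add_of_le' hb
  obtain ⟨s, hs⟩ := Nat.exists_eq_add_of_lt hc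
  have hc' : c = (a + 2) ^ 2 + s + 1 - (a + 2) := by omega
  have hy : (a + 2) * c = (s + 1) + a * (a + 2 + c) + (a + 2 + c) := by nlinarith
  have hy' : (a + 2) * c - (a + 2) - c = (s + 1) + a * (a + 2 + c) := by omega
  have hs' : a + 2 + c - (a + 2) ^ 2 = s + 1 := by omega
  rw [hy', hy, hs', negCFLength_add_mul (by omega), hs, add_assoc ((a + 2) ^ 2),
    negCFLength_add_self_left]
  simp

theorem negCFLength_bident_small {b c : ℕ} (hb : 2 ≤ b) (hc : b + c ≤ b ^ 2) :
    negCFLength (b * c) (b * c - b - c) < b ^ 2 + b - 3 := by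
  have hb2 : 4 ≤ b ^ 2 := by nlinarith
  rcases Nat.eq_zero_or_pos (b * c - b - c) with h | h
  · rw [h, negCFLength_zero_right]
    omega
  obtain ⟨a, rfl⟩ := Nat.exists_eq_add_of_le' hb
  set m := a + 2 + c with hm
  set y := (a + 2) * c - (a + 2) - c with hy
  have hx : (a + 2) * c = y + m := by omega
  have hm0 : 0 < m := by omega
  have hdiv := Nat.mod_add_div' y m
  have hmod := Nat.mod_lt y hm0
  have hlen := negCFLength_add_mul hm0 (y % m) (y / m)
  rw [hdiv, ← hx] at hlen
  have hle := negCFLength_le m (y % m)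
  have hya : y + (a + 2) ^ 2 = a * m + m := by nlinarith
  rw [hlen]
  rcases Nat.lt_or_ge (y / m) a with hq | hq
  · omega
  · have h1 : a * m ≤ y / m * m := Nat.mul_le_mul_right m hq
    have h2 : y / m = a := by
      apply le_antisymm _ hq
      apply Nat.le_of_mul_le_mul_right _ hm0
      omega
    omega

/-- For each sufficiently large `t`, exactly `b ^ 2` values of `c` make the negative continued
fraction of `1 / (1 - 1 / b - 1 / c)` have length `t`. -/
theorem ncard_negCFLength_bident {b t : ℕ} (hb : 2 ≤ b) (ht : b ^ 2 + b - 3 ≤ t) :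
    {c | negCFLength (b * c) (b * c - b - c) = t}.ncard = b ^ 2 := by
  have hb2 : 4 ≤ b ^ 2 := by nlinarith
  have hbb : b ≤ b ^ 2 := by nlinarith
  rw [← ncard_negCFLength_eq (x := b ^ 2) (t := t - (b - 2)) (by omega) (by omega)]
  have hpos : ∀ s, negCFLength (b ^ 2) s = t - (b - 2) → 0 < s := by
    intro s hs
    have := negCFLength_le (b ^ 2) s
    omega
  have himage : {c | negCFLength (b * c) (b * c - b - c) = t} =
      (fun s => s + (b ^ 2 - b)) '' {s | negCFLength (b ^ 2) s = t - (b - 2)} := by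
    ext c
    simp only [Set.mem_ofPred_eq, Set.mem_image]
    constructor
    · intro hc
      have hlarge : b ^ 2 < b + c := by
        by_contra! hsmall
        have := negCFLength_bident_small hb hsmall
        omega
      rw [negCFLength_bident_large hb hlarge] at hc
      exact ⟨b + c - b ^ 2, by omega, by omega⟩
    · rintro ⟨s, hs, rfl⟩
      have := hpos s hs
      rw [negCFLength_bident_large hb (by omega),
        show b + (s + (b ^ 2 - b)) - b ^ 2 = s by omega, hs]
      omega
  rw [himage, Set.ncard_image_of_injective _ (add_left_injective _)]

/-- The remainders of the negative continued fraction expansion of `x / y`. -/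
def negCFSeq : ℕ → ℕ → ℕ → ℕ
  | x, _, 0 => x
  | x, y, k + 1 => negCFSeq y (negMod x y) k

theorem negCFSeq_succ_succ (x y k : ℕ) :
    negCFSeq x y (k + 2) = negMod (negCFSeq x y k) (negCFSeq x y (k + 1)) := by
  induction k generalizing x y with
  | zero => rfl
  | succ k ih => exact ih y (negMod x y)

theorem negCFSeq_zero_zero (k : ℕ) : negCFSeq 0 0 k = 0 := by
  induction k with
  | zero => rfl
  | succ k ih => rw [negCFSeq, negMod_zero_right, ih]

theorem negCFSeq_pos_iff {x y : ℕ} (hx : 0 < x) (i : ℕ) :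
    0 < negCFSeq x y i ↔ i ≤ negCFLength x y := by
  induction i generalizing x y with
  | zero => simpa [negCFSeq] using hx
  | succ i ih =>
    rw [negCFSeq]
    rcases Nat.eq_zero_or_pos y with rfl | hy
    · simp [negMod_zero_right, negCFSeq_zero_zero, negCFLength_zero_right]
    · rw [ih hy, negCFLength_of_pos hy, Nat.add_le_add_iff_right]

theorem negCFSeq_succ_lt {x y i : ℕ} (hxy : y < x) (h : 0 < negCFSeq x y i) :
    negCFSeq x y (i + 1) < negCFSeq x y i := by
  cases i with
  | zero => simpa [negCFSeq] using hxy
  | succ i => rw [negCFSeq_succ_succ]; exact negMod_lt h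

theorem succ_lt_of_two_le_mul {t : ℕ} {d r : ℕ → ℕ} (hd : ∀ i, 1 ≤ i → i ≤ t → 2 ≤ d i)
    (hr : ∀ i, 1 ≤ i → i ≤ t → d i * r i = r (i - 1) + r (i + 1)) (hpos : 0 < r t)
    (hzero : r (t + 1) = 0) {i : ℕ} (hi : i ≤ t) : r (i + 1) < r i := by
  induction hi using Nat.decreasingInduction with
  | self => omega
  | of_succ k hk ih =>
    have h1 := hr (k + 1) (by omega) hk
    have h2 := Nat.mul_le_mul_right (r (k + 1)) (hd (k + 1) (by omega) hk)
    rw [Nat.add_sub_cancel] at h1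
    omega

theorem negCFLength_eq_of_recurrence {t : ℕ} {d r : ℕ → ℕ}
    (hr : ∀ i < t, d (i + 1) * r (i + 1) = r i + r (i + 2))
    (hlt : ∀ i ≤ t, r (i + 1) < r i) (hzero : r (t + 1) = 0) :
    negCFLength (r 0) (r 1) = t := by
  induction t generalizing d r with
  | zero => rw [hzero, negCFLength_zero_right]
  | succ t ih =>
    rw [negCFLength_of_mul_eq_add (hr 0 (by omega)) (hlt 1 (by omega))]
    rw [ih (d := fun i => d (i + 1)) (r := fun i => r (i + 1))
      (fun i hi => hr (i + 1) (by omega)) (fun i hi => hlt (i + 1) (by omega)) hzero]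

namespace SmoothArithOn

variable {n : ℕ}

theorem recurrence (S : SmoothArithOn n) {i : ℕ} (h1 : 1 ≤ i) (hi : i ≤ n - 3) :
    S.d i * S.r i = S.r (i - 1) + S.r (i + 1) := by
  obtain ⟨-, -, -, -, -, -, -, -, -, -, -, hmid, hend, -⟩ := S.arith
  rcases Nat.lt_or_ge i (n - 3) with h | h
  · exact hmid i h1 h
  · obtain rfl : i = n - 3 := le_antisymm hi h
    rw [hend h1, S.r_pad _ (Nat.lt_succ_self _), add_zero]

theorem r_pos (S : SmoothArithOn n) {i : ℕ} (hi : i ≤ n - 3) : 0 < S.r i :=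
  S.arith.2.2.2.2.2.2.1 i hi

theorem r_succ_lt (S : SmoothArithOn n) {i : ℕ} (hi : i ≤ n - 3) : S.r (i + 1) < S.r i :=
  succ_lt_of_two_le_mul S.smooth.2.2 (fun _ => S.recurrence) (S.r_pos le_rfl)
    (S.r_pad _ (Nat.lt_succ_self _)) hi

theorem dx_mul (S : SmoothArithOn n) : S.dx * S.rx = S.r 0 := S.arith.2.2.2.2.2.2.2.1

theorem dy_mul (S : SmoothArithOn n) : S.dy * S.ry = S.r 0 := S.arith.2.2.2.2.2.2.2.2.1

theorem d_zero_mul (S : SmoothArithOn n) : S.d 0 * S.r 0 = S.rx + S.ry + S.r 1 := by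
  obtain ⟨-, -, -, -, -, -, -, -, -, h1, h0, -⟩ := S.arith
  rcases Nat.eq_zero_or_pos (n - 3) with h | h
  · rw [h0 h, S.r_pad 1 (by omega), add_zero]
  · exact h1 h

theorem d_zero (S : SmoothArithOn n) : S.d 0 = 1 := by
  have hx := Nat.mul_le_mul_right S.rx S.smooth.1
  have hy := Nat.mul_le_mul_right S.ry S.smooth.2.1
  have h1 : S.r 1 < S.r 0 := S.r_succ_lt (Nat.zero_le _)
  have h0 := S.d_zero_mul
  have hd : 0 < S.d 0 := S.arith.2.2.2.1 0 (Nat.zero_le _)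
  rw [S.dx_mul] at hx
  rw [S.dy_mul] at hy
  have : S.d 0 < 2 := by
    by_contra! h
    have := Nat.mul_le_mul_right (S.r 0) h
    omega
  omega

theorem r_zero (S : SmoothArithOn n) : S.r 0 = S.rx + S.ry + S.r 1 := by
  rw [← S.d_zero_mul, S.d_zero, one_mul]

theorem mul_r_zero (S : SmoothArithOn n) :
    S.dx * S.dy * S.r 0 = (S.dx + S.dy) * S.r 0 + S.dx * S.dy * S.r 1 := by
  have hx := S.dx_mul
  have hy := S.dy_mul
  have h0 := S.r_zero
  calc S.dx * S.dy * S.r 0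
      = S.dy * (S.dx * S.rx) + S.dx * (S.dy * S.ry) + S.dx * S.dy * S.r 1 := by
        rw [h0]; ring
    _ = _ := by rw [hx, hy]; ring

theorem negCFLength_eq (S : SmoothArithOn n) :
    negCFLength (S.dx * S.dy) (S.dx * S.dy - S.dx - S.dy) = n - 3 := by
  have h0 := S.r_pos (Nat.zero_le _)
  have hx := S.smooth.1
  have hy := S.smooth.2.1
  have hlen : negCFLength (S.r 0) (S.r 1) = n - 3 :=
    negCFLength_eq_of_recurrence (fun i hi => S.recurrence (i := i + 1) (by omega) (by omega))
      (fun i => S.r_succ_lt) (S.r_pad _ (Nat.lt_succ_self _))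
  rw [← negCFLength_mul h0, ← hlen,
    ← negCFLength_mul (k := S.dx * S.dy) (by positivity) (S.r 0) (S.r 1)]
  have hm := S.mul_r_zero
  congr 1
  · ring
  · rw [Nat.sub_sub, Nat.mul_sub, mul_comm _ (S.dx * S.dy), mul_comm _ (S.dx + S.dy)]
    omega

theorem r_zero_mul_r {S T : SmoothArithOn n} (hx : S.dx = T.dx) (hy : S.dy = T.dy) (i : ℕ) :
    T.r 0 * S.r i = S.r 0 * T.r i := by
  induction i using Nat.strong_induction_on with
  | _ i ih =>
    match i, ih with
    | 0, _ => exact mul_comm _ _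
    | 1, _ =>
      have hS := S.mul_r_zero
      have hT := T.mul_r_zero
      rw [hx, hy] at hS
      have hdx := T.smooth.1
      have hdy := T.smooth.2.1
      have hpos : 0 < T.dx * T.dy := by positivity
      zify at *
      refine mul_left_cancel₀ hpos.ne' ?_
      linear_combination S.r 0 * hT - T.r 0 * hS
    | i + 2, ih =>
      rcases Nat.lt_or_ge i (n - 3) with hi | hi
      · have h0 := ih i (by omega)
        have h1 := ih (i + 1) (by omega)
        have hS := congrArg (T.r 0 * ·) (S.recurrence (i := i + 1) (by omega) hi)
        have hT := congrArg (S.r 0 * ·) (T.recurrence (i := i + 1) (by omega) hi)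
        have hSlt := Nat.mul_lt_mul_of_pos_left (S.r_succ_lt hi) (T.r_pos (Nat.zero_le _))
        have hTlt := Nat.mul_lt_mul_of_pos_left (T.r_succ_lt hi) (S.r_pos (Nat.zero_le _))
        simp only [Nat.add_sub_cancel, mul_left_comm _ (SmoothArithOn.d _ _), mul_add,
          ← h0, ← h1] at hS hT hTlt
        rw [← negMod_eq_of_mul_eq_add hS hSlt, ← negMod_eq_of_mul_eq_add hT hTlt]
      · rw [S.r_pad (i + 2) (by omega), T.r_pad (i + 2) (by omega), mul_zero, mul_zero]

theorem r_zero_dvd {S T : SmoothArithOn n} (hx : S.dx = T.dx) (hy : S.dy = T.dy) :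
    S.r 0 ∣ T.r 0 := by
  have hmul := r_zero_mul_r hx hy
  have hdx : 0 < S.dx := S.arith.2.1
  have hdy : 0 < S.dy := S.arith.2.2.1
  have hSx := S.dx_mul
  have hSy := S.dy_mul
  have hTx := T.dx_mul
  have hTy := T.dy_mul
  rw [← hx] at hTx
  rw [← hy] at hTy
  obtain ⟨-, -, -, -, -, -, -, -, -, -, -, -, -, hgcd⟩ := S.arith
  have hg : 0 < Nat.gcd (S.r 0) (T.r 0) := Nat.gcd_pos_of_pos_left _ (S.r_pos (Nat.zero_le _))
  obtain ⟨a, a', hco, ha, ha'⟩ := Nat.exists_coprime (S.r 0) (T.r 0)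
  have key : ∀ u v, T.r 0 * u = S.r 0 * v → a ∣ u := by
    intro u v huv
    refine hco.dvd_of_dvd_mul_left ⟨v, ?_⟩
    refine Nat.eq_of_mul_eq_mul_left hg ?_
    calc _ = (a' * (S.r 0).gcd (T.r 0)) * u := by ring
      _ = (a * (S.r 0).gcd (T.r 0)) * v := by rw [← ha, ← ha', huv]
      _ = _ := by ring
  have ha1 : a = 1 := by
    refine hgcd a (key _ T.rx ?_) (key _ T.ry ?_) fun i _ => key _ _ (hmul i)
    · rw [← hSx, ← hTx]; ring
    · rw [← hSy, ← hTy]; ring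
  rw [ha, ha1, one_mul]
  exact Nat.gcd_dvd_right _ _

theorem ext_of_dx_dy {S T : SmoothArithOn n} (hx : S.dx = T.dx) (hy : S.dy = T.dy) : S = T := by
  have h0 : S.r 0 = T.r 0 := Nat.dvd_antisymm (r_zero_dvd hx hy) (r_zero_dvd hx.symm hy.symm)
  have hr : S.r = T.r := by
    funext i
    have h := r_zero_mul_r hx hy i
    rw [h0] at h
    exact Nat.eq_of_mul_eq_mul_left (T.r_pos (Nat.zero_le _)) h
  have hrx : S.rx = T.rx := by
    refine Nat.eq_of_mul_eq_mul_left T.arith.2.1 ?_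
    rw [T.dx_mul, ← hx, S.dx_mul, h0]
  have hry : S.ry = T.ry := by
    refine Nat.eq_of_mul_eq_mul_left T.arith.2.2.1 ?_
    rw [T.dy_mul, ← hy, S.dy_mul, h0]
  have hd : S.d = T.d := by
    funext i
    rcases Nat.lt_or_ge (n - 3) i with hi | hi
    · rw [S.d_pad i hi, T.d_pad i hi]
    · rcases Nat.eq_zero_or_pos i with rfl | h1
      · rw [S.d_zero, T.d_zero]
      · refine Nat.eq_of_mul_eq_mul_right (T.r_pos hi) ?_
        rw [T.recurrence h1 hi, ← hr, S.recurrence h1 hi]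
  cases S
  cases T
  subst hx hy hd hrx hry hr
  rfl

theorem exists_of_negCFLength {b c : ℕ} (hn : 4 ≤ n) (hb : 2 ≤ b)
    (hlen : negCFLength (b * c) (b * c - b - c) = n - 3) :
    ∃ S : SmoothArithOn n, S.dx = b ∧ S.dy = c := by
  have hy : 0 < b * c - b - c := by
    by_contra! h
    rw [Nat.le_zero.mp h, negCFLength_zero_right] at hlen
    omega
  have hc : 2 ≤ c := by
    by_contra! h
    interval_cases c <;> omega
  have hg : 0 < Nat.gcd b c := Nat.gcd_pos_of_pos_left _ (by omega)
  obtain ⟨b', c', hco, hb', hc'⟩ := Nat.exists_coprime b c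
  set g := Nat.gcd b c
  set x := g * b' * c' with hx
  have hx' : g * x = b * c := by rw [hb', hc', hx]; ring
  have hy' : g * (x - b' - c') = b * c - b - c := by
    rw [Nat.mul_sub, Nat.mul_sub, hx']
    congr 1
    · congr 1
      rw [hb']; ring
    · rw [hc']; ring
  have hb0 : 0 < b' := Nat.pos_of_ne_zero fun h => by simp [h] at hb'; omega
  have hc0 : 0 < c' := Nat.pos_of_ne_zero fun h => by simp [h] at hc'; omega
  have hy0 : 0 < x - b' - c' := by
    refine Nat.pos_of_mul_pos_left (a := g) ?_
    rw [hy']; exact hy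
  have hx0 : 0 < x := by positivity
  rw [← hy', ← hx', negCFLength_mul hg] at hlen
  set r := negCFSeq x (x - b' - c') with hr
  have hpos : ∀ i, 0 < r i ↔ i ≤ n - 3 := fun i => by rw [hr, negCFSeq_pos_iff hx0, hlen]
  have hzero : ∀ i, n - 3 < i → r i = 0 := fun i hi => by
    have := hpos i
    omega
  have hr0 : r 0 = x := rfl
  have hr1 : r 1 = x - b' - c' := rfl
  have hmid : ∀ i, 1 ≤ i → i ≤ n - 3 →
      (r (i - 1) + r (i + 1)) / r i * r i = r (i - 1) + r (i + 1) := by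
    intro i h1 hi
    obtain ⟨i, rfl⟩ := Nat.exists_eq_add_of_le' h1
    obtain ⟨e, he⟩ := exists_mul_eq_add_negMod (x := r i) ((hpos _).2 hi)
    refine Nat.div_mul_cancel ⟨e, ?_⟩
    rw [mul_comm, he, Nat.add_sub_cancel, hr, negCFSeq_succ_succ]
  set d : ℕ → ℕ := fun i => if i = 0 then 1 else (r (i - 1) + r (i + 1)) / r i with hd
  have hd0 : d 0 = 1 := rfl
  have hd1 : ∀ i, 1 ≤ i → d i = (r (i - 1) + r (i + 1)) / r i := fun i hi => by
    simp [hd, Nat.one_le_iff_ne_zero.mp hi]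
  have hd2 : ∀ i, 1 ≤ i → i ≤ n - 3 → 2 ≤ d i := by
    intro i h1 hi
    have h := hmid i h1 hi
    rw [← hd1 i h1] at h
    by_contra! hlt
    have hle := Nat.mul_le_mul_right (r i) (Nat.le_of_lt_succ hlt)
    have hdec := negCFSeq_succ_lt (x := x) (y := x - b' - c') (i := i - 1) (by omega)
      ((hpos _).2 (by omega))
    rw [Nat.sub_add_cancel h1, ← hr] at hdec
    omega
  refine ⟨⟨b, c, d, c', b', r, ⟨by omega, by omega, by omega, ?_, hc0, hb0,
    fun i => (hpos i).2, ?_, ?_, ?_, by omega, ?_, ?_, ?_⟩, ⟨hb, hc, hd2⟩, ?_, hzero⟩, rfl, rfl⟩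
  · intro i hi
    rcases Nat.eq_zero_or_pos i with rfl | h1
    · rw [hd0]; omega
    · have := hd2 i h1 hi
      omega
  · rw [hr0, hx, hb']; ring
  · rw [hr0, hx, hc']; ring
  · intro _
    rw [hd0, hr0, hr1]
    omega
  · intro i h1 hi
    rw [hd1 i h1, hmid i h1 (by omega)]
  · intro h1
    rw [hd1 _ h1, hmid _ h1 le_rfl, hzero _ (Nat.lt_succ_self _), add_zero]
  · intro k hkc hkb _
    exact Nat.eq_one_of_dvd_coprimes hco hkb hkc
  · intro i hi
    rw [hd1 i (by omega), hzero i hi, Nat.div_zero]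

end SmoothArithOn

/-- **Theorem 3.5.**  For any `b ≥ 2` and any `n ≥ b² + b`, there are exactly `b²` smooth
arithmetical structures on `D_n` with `d_x = b` (equivalently, with `r̄_y = b`). -/
theorem card_smooth_with_dx (b n : ℕ) (hb : 2 ≤ b) (hn : b ^ 2 + b ≤ n) :
    Nat.card {S : SmoothArithOn n // S.dx = b} = b ^ 2 := by
  have hb2 : 4 ≤ b ^ 2 := by nlinarith
  rw [← ncard_negCFLength_bident (t := n - 3) hb (by omega), ← Nat.card_coe_set_eq]
  refine Nat.card_eq_of_bijective
    (fun S : {S : SmoothArithOn n // S.dx = b} =>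
      (⟨S.1.dy, by simpa only [S.2, Set.mem_ofPred_eq] using S.1.negCFLength_eq⟩ :
        {c | negCFLength (b * c) (b * c - b - c) = n - 3})) ⟨?_, ?_⟩
  · intro S T h
    exact Subtype.ext (SmoothArithOn.ext_of_dx_dy (S.2.trans T.2.symm) (congrArg Subtype.val h))
  · rintro ⟨c, hc⟩
    obtain ⟨S, hx, hy⟩ := SmoothArithOn.exists_of_negCFLength (n := n) (by omega) hb hc
    exact ⟨⟨S, hx⟩, Subtype.ext hy⟩
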